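/- Let (k_1, k_1^{-1}, e_1, f_1, k_2, k_2^{-1}, e_2, f_2) be a module-algebra structure of U_q(sl(3)) on the quantum 3-space A_q(3) with k_1(x_1) = q⁻²x_1, k_1(x_2) = q⁻¹x_2, k_1(x_3) = q⁻¹x_3, k_2(x_1) = qx_1, k_2(x_2) = q²x_2, k_2(x_3) = q⁻¹x_3. Then there exist a₀, e₀, a₃, ξ₄ ∈ ℂ∖{0} with a₃ξ₄ = −qe₀⁻¹a₀⁻¹ such that e_1(x_1) = a₀·1, e_1(x_2) = e_1(x_3) = 0, e_2(x_1) = −qe₀⁻¹x_1x_2, e_2(x_2) = −qe₀⁻¹x_2², e_2(x_3) = a₃x_1 + e₀⁻¹x_2x_3, f_1(x_1) = −qa₀⁻¹x_1², f_1(x_2) = −qa₀⁻¹x_1x_2, f_1(x_3) = −qa₀⁻¹x_1x_3 + ξ₄x_2x_3², f_2(x_1) = 0, f_2(x_2) = e₀·1, f_2(x_3) = 0. Conversely, each such assignment (with a₃ξ₄ = −qe₀⁻¹a₀⁻¹) defines a module-algebra structure of U_q(sl(3)) on A_q(3), and every such structure is isomorphic to the one with a₀ = e₀ = a₃ = 1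 and ξ₄ = −q. -/

import Mathlib

noncomputable section

open scoped BigOperators

/-- The defining relations of the quantum `n`-space `A_q(n)`:
`x_i x_j = q • (x_j x_i)` for `i > j`. -/
inductive QRel (q : ℂ) (n : ℕ) : FreeAlgebra ℂ (Fin n) → FreeAlgebra ℂ (Fin n) → Prop
  | rel (i j : Fin n) (h : j < i) :
      QRel q n (FreeAlgebra.ι ℂ i * FreeAlgebra.ι ℂ j)
        (q • (FreeAlgebra.ι ℂ j * FreeAlgebra.ι ℂ i))

/-- The quantum `n`-space `A_q(n)`. -/
abbrev QSpace (q : ℂ) (n : ℕ) : Type := RingQuot (QRel q n)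

/-- The generator `x_i` of the quantum `n`-space. -/
def Xg (q : ℂ) (n : ℕ) (i : Fin n) : QSpace q n :=
  RingQuot.mkAlgHom ℂ (QRel q n) (FreeAlgebra.ι ℂ i)

/-- The Cartan matrix of `sl(m+1)`: `a_{ii} = 2`, `a_{ij} = -1` if `|i-j| = 1`,
`a_{ij} = 0` if `|i-j| > 1`. -/
def cartan (m : ℕ) (i j : Fin m) : ℤ :=
  if i = j then 2 else if ((i : ℤ) - (j : ℤ)).natAbs = 1 then -1 else 0

/-- A module-algebra structure of `U_q(sl(m+1))` on a unital `ℂ`-algebra `A`: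
`ℂ`-linear maps `k_i` (unital algebra automorphisms with two-sided inverses `(k i).symm`),
`e_i`, `f_i` for `1 ≤ i ≤ m`, satisfying the twisted Leibniz rules and the defining
operator relations of `U_q(sl(m+1))`. -/
structure UqslMA (q : ℂ) (m : ℕ) (A : Type) [Ring A] [Algebra ℂ A] where
  k : Fin m → (A ≃ₐ[ℂ] A)
  e : Fin m → (A →ₗ[ℂ] A)
  f : Fin m → (A →ₗ[ℂ] A)
  e_mul : ∀ (i : Fin m) (a b : A), e i (a * b) = a * e i b + e i a * k i b
  f_mul : ∀ (i : Fin m) (a b : A), f i (a * b) = (k i).symm a * f i b + f i a * b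
  e_one : ∀ i : Fin m, e i 1 = 0
  f_one : ∀ i : Fin m, f i 1 = 0
  k_comm : ∀ (i j : Fin m) (a : A), k i (k j a) = k j (k i a)
  ke : ∀ (i j : Fin m) (a : A), k i (e j ((k i).symm a)) = q ^ cartan m i j • e j a
  kf : ∀ (i j : Fin m) (a : A), k i (f j ((k i).symm a)) = q ^ (-cartan m i j) • f j a
  ef : ∀ (i j : Fin m) (a : A),
      e i (f j a) - f j (e i a) =
        if i = j then (q - q⁻¹)⁻¹ • (k i a - (k i).symm a) else 0
  ee_comm : ∀ i j : Fin m, cartan m i j = 0 → ∀ a : A, e i (e j a) = e j (e i a)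
  ff_comm : ∀ i j : Fin m, cartan m i j = 0 → ∀ a : A, f i (f j a) = f j (f i a)
  serre_e : ∀ i j : Fin m, cartan m i j = -1 → ∀ a : A,
      e i (e i (e j a)) - (q + q⁻¹) • e i (e j (e i a)) + e j (e i (e i a)) = 0
  serre_f : ∀ i j : Fin m, cartan m i j = -1 → ∀ a : A,
      f i (f i (f j a)) - (q + q⁻¹) • f i (f j (f i a)) + f j (f i (f i a)) = 0

/-- Isomorphism of module-algebra structures: an algebra automorphism `ψ` of `A` with
`ψ ∘ π₁(h) ∘ ψ⁻¹ = π₂(h)` for every generator `h ∈ {k_i^{±1}, e_i, f_i}`. -/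
def UqslMA.Iso {q : ℂ} {m : ℕ} {A : Type} [Ring A] [Algebra ℂ A]
    (π₁ π₂ : UqslMA q m A) : Prop :=
  ∃ ψ : A ≃ₐ[ℂ] A,
    (∀ (i : Fin m) (a : A), ψ (π₁.k i (ψ.symm a)) = π₂.k i a) ∧
    (∀ (i : Fin m) (a : A), ψ ((π₁.k i).symm (ψ.symm a)) = (π₂.k i).symm a) ∧
    (∀ (i : Fin m) (a : A), ψ (π₁.e i (ψ.symm a)) = π₂.e i a) ∧
    (∀ (i : Fin m) (a : A), ψ (π₁.f i (ψ.symm a)) = π₂.f i a)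

/-- The generator `x_1` of the quantum 3-space. -/
def Z1 (q : ℂ) : QSpace q 3 := Xg q 3 0
/-- The generator `x_2` of the quantum 3-space. -/
def Z2 (q : ℂ) : QSpace q 3 := Xg q 3 1
/-- The generator `x_3` of the quantum 3-space. -/
def Z3 (q : ℂ) : QSpace q 3 := Xg q 3 2

/-- The `k`-action of case `(A2)|(B7)`. -/
def KCond14 (q : ℂ) (π : UqslMA q 2 (QSpace q 3)) : Prop :=
  π.k 0 (Z1 q) = (q ^ (-2 : ℤ)) • Z1 q ∧ π.k 0 (Z2 q) = q⁻¹ • Z2 q ∧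
  π.k 0 (Z3 q) = q⁻¹ • Z3 q ∧
  π.k 1 (Z1 q) = q • Z1 q ∧ π.k 1 (Z2 q) = (q ^ (2 : ℕ)) • Z2 q ∧
  π.k 1 (Z3 q) = q⁻¹ • Z3 q

/-- The `e`/`f`-action of case `(A2)|(B7)` with parameters `a₀`, `e₀`, `a₃`, `ξ₄`. -/
def EFDesc14 (q : ℂ) (π : UqslMA q 2 (QSpace q 3)) (a₀ e₀ a₃ ξ₄ : ℂ) : Prop :=
  π.e 0 (Z1 q) = a₀ • 1 ∧ π.e 0 (Z2 q) = 0 ∧ π.e 0 (Z3 q) = 0 ∧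
  π.e 1 (Z1 q) = (-q * e₀⁻¹) • (Z1 q * Z2 q) ∧
  π.e 1 (Z2 q) = (-q * e₀⁻¹) • (Z2 q ^ 2) ∧
  π.e 1 (Z3 q) = a₃ • Z1 q + e₀⁻¹ • (Z2 q * Z3 q) ∧
  π.f 0 (Z1 q) = (-q * a₀⁻¹) • (Z1 q ^ 2) ∧
  π.f 0 (Z2 q) = (-q * a₀⁻¹) • (Z1 q * Z2 q) ∧
  π.f 0 (Z3 q) = (-q * a₀⁻¹) • (Z1 q * Z3 q) + ξ₄ • (Z2 q * Z3 q ^ 2) ∧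
  π.f 1 (Z1 q) = 0 ∧ π.f 1 (Z2 q) = e₀ • 1 ∧ π.f 1 (Z3 q) = 0


/-! ### Universal property of the quantum space -/

/-- The algebra map out of `A_q(n)` determined by images of the generators that satisfy the
defining relations. -/
def QSpace.lift {q : ℂ} {n : ℕ} {B : Type} [Ring B] [Algebra ℂ B] (y : Fin n → B)
    (h : ∀ i j : Fin n, j < i → y i * y j = q • (y j * y i)) : QSpace q n →ₐ[ℂ] B :=
  RingQuot.liftAlgHom ℂ ⟨FreeAlgebra.lift ℂ y, by
    rintro _ _ ⟨i, j, hij⟩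
    simpa using h i j hij⟩

@[simp]
lemma QSpace.lift_Xg {q : ℂ} {n : ℕ} {B : Type} [Ring B] [Algebra ℂ B] (y : Fin n → B)
    (h : ∀ i j : Fin n, j < i → y i * y j = q • (y j * y i)) (i : Fin n) :
    QSpace.lift y h (Xg q n i) = y i := by
  simp [QSpace.lift, Xg]

lemma Xg_mul_Xg (q : ℂ) (n : ℕ) {i j : Fin n} (h : j < i) :
    Xg q n i * Xg q n j = q • (Xg q n j * Xg q n i) := by
  have := RingQuot.mkAlgHom_rel ℂ (QRel.rel (q := q) i j h)
  simpa [Xg] using this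

lemma QSpace.induction {q : ℂ} {n : ℕ} {P : QSpace q n → Prop}
    (smul_one : ∀ c : ℂ, P (c • 1)) (gen : ∀ i, P (Xg q n i))
    (mul : ∀ a b, P a → P b → P (a * b)) (add : ∀ a b, P a → P b → P (a + b))
    (a : QSpace q n) : P a := by
  obtain ⟨w, rfl⟩ := RingQuot.mkAlgHom_surjective ℂ (QRel q n) a
  induction w using FreeAlgebra.induction with
  | grade0 c =>
    rw [AlgHom.commutes, Algebra.algebraMap_eq_smul_one]
    exact smul_one c
  | grade1 i => exact gen i
  | mul a b ha hb => rw [map_mul]; exact mul _ _ ha hb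
  | add a b ha hb => rw [map_add]; exact add _ _ ha hb

lemma QSpace.algHom_ext_apply {q : ℂ} {n : ℕ} {B : Type} [Ring B] [Algebra ℂ B]
    {φ ψ : QSpace q n →ₐ[ℂ] B} (h : ∀ i, φ (Xg q n i) = ψ (Xg q n i)) (a : QSpace q n) :
    φ a = ψ a := by
  induction a using QSpace.induction with
  | smul_one c => simp
  | gen i => exact h i
  | mul a b ha hb => simp [ha, hb]
  | add a b ha hb => simp [ha, hb]

/-- Two linear maps satisfying the same twisted Leibniz rule agree as soon as they agree at `1`
and on the generators. -/
lemma QSpace.twisted_ext {q : ℂ} {n : ℕ} {B : Type} [Ring B] [Algebra ℂ B]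
    {D D' : QSpace q n →ₗ[ℂ] B} {L R : QSpace q n → B}
    (hD : ∀ a b, D (a * b) = L a * D b + D a * R b)
    (hD' : ∀ a b, D' (a * b) = L a * D' b + D' a * R b)
    (h1 : D 1 = D' 1) (h : ∀ i, D (Xg q n i) = D' (Xg q n i)) (a : QSpace q n) :
    D a = D' a := by
  induction a using QSpace.induction with
  | smul_one c => simp [h1]
  | gen i => exact h i
  | mul a b ha hb => rw [hD, hD', ha, hb]
  | add a b ha hb => simp [ha, hb]

/-- Twisted derivations of `A_q(n)` exist with any values on the generators that are compatible
with the defining relations. -/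
lemma QSpace.exists_twisted {q : ℂ} {n : ℕ} (L R : QSpace q n →ₐ[ℂ] QSpace q n)
    (d : Fin n → QSpace q n)
    (h : ∀ i j : Fin n, j < i →
      L (Xg q n i) * d j + d i * R (Xg q n j) =
        q • (L (Xg q n j) * d i + d j * R (Xg q n i))) :
    ∃ D : QSpace q n →ₗ[ℂ] QSpace q n, (∀ i, D (Xg q n i) = d i) ∧ D 1 = 0 ∧
      ∀ a b, D (a * b) = L a * D b + D a * R b := by
  let Φ : QSpace q n →ₐ[ℂ] Matrix (Fin 2) (Fin 2) (QSpace q n) :=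
    QSpace.lift (fun i => !![L (Xg q n i), d i; 0, R (Xg q n i)]) (by
      intro i j hij
      ext s t
      fin_cases s <;> fin_cases t
      · simp [← map_mul, Xg_mul_Xg q n hij]
      · simpa using h i j hij
      · simp
      · simp [← map_mul, Xg_mul_Xg q n hij])
  have hΦ : ∀ a, Φ a 0 0 = L a ∧ Φ a 1 0 = 0 ∧ Φ a 1 1 = R a := by
    intro a
    induction a using QSpace.induction with
    | smul_one c => simp
    | gen i => simp [Φ]
    | mul a b ha hb =>
      obtain ⟨h1, h2, h3⟩ := ha
      obtain ⟨h4, h5, h6⟩ := hb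
      simp [Matrix.mul_apply, h1, h2, h3, h4, h5, h6]
    | add a b ha hb =>
      obtain ⟨h1, h2, h3⟩ := ha
      obtain ⟨h4, h5, h6⟩ := hb
      simp [h1, h2, h3, h4, h5, h6]
  refine ⟨(Matrix.entryLinearMap ℂ (QSpace q n) 0 1).comp Φ.toLinearMap, fun i => by simp [Φ],
    by simp, fun a b => ?_⟩
  simp [Matrix.mul_apply, (hΦ a).1, (hΦ b).2.2]

/-- The automorphism of `A_q(n)` rescaling each generator. -/
def QSpace.scale {q : ℂ} {n : ℕ} (c : Fin n → ℂˣ) : QSpace q n ≃ₐ[ℂ] QSpace q n :=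
  have key : ∀ c : Fin n → ℂˣ, ∀ i j : Fin n, j < i →
      ((c i : ℂ) • Xg q n i) * ((c j : ℂ) • Xg q n j) =
        q • (((c j : ℂ) • Xg q n j) * ((c i : ℂ) • Xg q n i)) := by
    intro c i j hij
    simp only [smul_mul_assoc, mul_smul_comm, Xg_mul_Xg q n hij]
    module
  AlgEquiv.ofAlgHom (QSpace.lift (fun i => (c i : ℂ) • Xg q n i) (key c))
    (QSpace.lift (fun i => ((c i)⁻¹ : ℂˣ).1 • Xg q n i) (key fun i => (c i)⁻¹))
    (AlgHom.ext (QSpace.algHom_ext_apply (by simp [smul_smul])))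
    (AlgHom.ext (QSpace.algHom_ext_apply (by simp [smul_smul])))

@[simp]
lemma QSpace.scale_Xg {q : ℂ} {n : ℕ} (c : Fin n → ℂˣ) (i : Fin n) :
    QSpace.scale c (Xg q n i) = (c i : ℂ) • Xg q n i := by
  simp [QSpace.scale]

@[simp]
lemma QSpace.scale_symm_Xg {q : ℂ} {n : ℕ} (c : Fin n → ℂˣ) (i : Fin n) :
    (QSpace.scale c).symm (Xg q n i) = (c i : ℂ)⁻¹ • Xg q n i := by
  rw [AlgEquiv.symm_apply_eq]
  simp [smul_smul]

/-! ### Reducing the relations of `U_q(sl(m+1))` to generators -/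

section TwistedLeibniz

variable {A : Type} [Ring A] [Algebra ℂ A] {q : ℂ}

lemma serre_mul_of_right_twisted (hq : q ≠ 0) {E₁ E₂ : A →ₗ[ℂ] A} {K₁ K₂ : A ≃ₐ[ℂ] A}
    (hE₁ : ∀ a b, E₁ (a * b) = a * E₁ b + E₁ a * K₁ b)
    (hE₂ : ∀ a b, E₂ (a * b) = a * E₂ b + E₂ a * K₂ b)
    (hK : ∀ a, K₂ (K₁ a) = K₁ (K₂ a))
    (h₁₁ : ∀ a, K₁ (E₁ a) = q ^ (2 : ℤ) • E₁ (K₁ a))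
    (h₁₂ : ∀ a, K₁ (E₂ a) = q ^ (-1 : ℤ) • E₂ (K₁ a))
    (h₂₁ : ∀ a, K₂ (E₁ a) = q ^ (-1 : ℤ) • E₁ (K₂ a)) (a b : A) :
    E₁ (E₁ (E₂ (a * b))) - (q + q⁻¹) • E₁ (E₂ (E₁ (a * b))) + E₂ (E₁ (E₁ (a * b))) =
      a * (E₁ (E₁ (E₂ b)) - (q + q⁻¹) • E₁ (E₂ (E₁ b)) + E₂ (E₁ (E₁ b))) +
      (E₁ (E₁ (E₂ a)) - (q + q⁻¹) • E₁ (E₂ (E₁ a)) + E₂ (E₁ (E₁ a))) * K₁ (K₁ (K₂ b)) := by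
  simp only [hE₁, hE₂, map_add, map_smul, h₁₁, h₁₂, h₂₁, hK, mul_add, add_mul, mul_sub, sub_mul,
    smul_mul_assoc, mul_smul_comm, smul_add, smul_smul]
  match_scalars <;> simp only [zpow_neg, zpow_one] <;> field_simp <;> ring

lemma serre_mul_of_left_twisted (hq : q ≠ 0) {F₁ F₂ : A →ₗ[ℂ] A} {L₁ L₂ : A ≃ₐ[ℂ] A}
    (hF₁ : ∀ a b, F₁ (a * b) = L₁ a * F₁ b + F₁ a * b)
    (hF₂ : ∀ a b, F₂ (a * b) = L₂ a * F₂ b + F₂ a * b)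
    (hL : ∀ a, L₂ (L₁ a) = L₁ (L₂ a))
    (h₁₁ : ∀ a, L₁ (F₁ a) = q ^ (2 : ℤ) • F₁ (L₁ a))
    (h₁₂ : ∀ a, L₁ (F₂ a) = q ^ (-1 : ℤ) • F₂ (L₁ a))
    (h₂₁ : ∀ a, L₂ (F₁ a) = q ^ (-1 : ℤ) • F₁ (L₂ a)) (a b : A) :
    F₁ (F₁ (F₂ (a * b))) - (q + q⁻¹) • F₁ (F₂ (F₁ (a * b))) + F₂ (F₁ (F₁ (a * b))) =
      L₁ (L₁ (L₂ a)) * (F₁ (F₁ (F₂ b)) - (q + q⁻¹) • F₁ (F₂ (F₁ b)) + F₂ (F₁ (F₁ b))) +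
      (F₁ (F₁ (F₂ a)) - (q + q⁻¹) • F₁ (F₂ (F₁ a)) + F₂ (F₁ (F₁ a))) * b := by
  simp only [hF₁, hF₂, map_add, map_smul, h₁₁, h₁₂, h₂₁, hL, mul_add, add_mul, mul_sub, sub_mul,
    smul_mul_assoc, mul_smul_comm, smul_add, smul_smul]
  match_scalars <;> simp only [zpow_neg, zpow_one] <;> field_simp <;> ring

lemma commutator_mul_of_twisted (hq : q ≠ 0) {E F : A →ₗ[ℂ] A} {K L : A ≃ₐ[ℂ] A} (c : ℤ)
    (hE : ∀ a b, E (a * b) = a * E b + E a * K b)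
    (hF : ∀ a b, F (a * b) = L.symm a * F b + F a * b)
    (hLE : ∀ a, L (E a) = q ^ c • E (L a))
    (hKF : ∀ a, K (F a) = q ^ (-c) • F (K a)) (a b : A) :
    E (F (a * b)) - F (E (a * b)) =
      L.symm a * (E (F b) - F (E b)) + (E (F a) - F (E a)) * K b := by
  have h : L.symm (E a) = q ^ (-c) • E (L.symm a) := by
    rw [AlgEquiv.symm_apply_eq, map_smul, hLE, smul_smul, ← zpow_add₀ hq]
    simp
  simp only [hE, hF, map_add, h, hKF, mul_sub, sub_mul, smul_mul_assoc, mul_smul_comm]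
  module

end TwistedLeibniz

lemma cartan_comm (m : ℕ) (i j : Fin m) : cartan m i j = cartan m j i := by
  simp only [cartan, eq_comm (a := i), ← Int.natAbs_neg ((i : ℤ) - j), neg_sub]

lemma cartan_self (m : ℕ) (i : Fin m) : cartan m i i = 2 := by
  simp [cartan]

/-- A module-algebra structure on `A_q(n)` from operators that obey the twisted Leibniz rules and
satisfy the remaining relations of `U_q(sl(m+1))` on the generators (when no two simple roots are
orthogonal). -/
def UqslMA.ofGenerators {q : ℂ} (hq : q ≠ 0) {m n : ℕ} (hm : ∀ i j, cartan m i j ≠ 0)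
    (k : Fin m → (QSpace q n ≃ₐ[ℂ] QSpace q n)) (e f : Fin m → (QSpace q n →ₗ[ℂ] QSpace q n))
    (e_mul : ∀ i a b, e i (a * b) = a * e i b + e i a * k i b)
    (f_mul : ∀ i a b, f i (a * b) = (k i).symm a * f i b + f i a * b)
    (e_one : ∀ i, e i 1 = 0) (f_one : ∀ i, f i 1 = 0)
    (k_comm : ∀ i j s, k i (k j (Xg q n s)) = k j (k i (Xg q n s)))
    (ke : ∀ i j s, k i (e j (Xg q n s)) = q ^ cartan m i j • e j (k i (Xg q n s)))
    (kf : ∀ i j s, k i (f j (Xg q n s)) = q ^ (-cartan m i j) • f j (k i (Xg q n s)))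
    (ef : ∀ i j s, e i (f j (Xg q n s)) - f j (e i (Xg q n s)) =
      if i = j then (q - q⁻¹)⁻¹ • (k i (Xg q n s) - (k i).symm (Xg q n s)) else 0)
    (serre_e : ∀ i j, cartan m i j = -1 → ∀ s, e i (e i (e j (Xg q n s))) -
      (q + q⁻¹) • e i (e j (e i (Xg q n s))) + e j (e i (e i (Xg q n s))) = 0)
    (serre_f : ∀ i j, cartan m i j = -1 → ∀ s, f i (f i (f j (Xg q n s))) -
      (q + q⁻¹) • f i (f j (f i (Xg q n s))) + f j (f i (f i (Xg q n s))) = 0) :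
    UqslMA q m (QSpace q n) :=
  have k_comm' : ∀ i j a, k i (k j a) = k j (k i a) := fun i j =>
    QSpace.algHom_ext_apply (φ := ((k j).trans (k i)).toAlgHom)
      (ψ := ((k i).trans (k j)).toAlgHom) (k_comm i j)
  have k_symm_comm : ∀ i j a, k i ((k j).symm a) = (k j).symm (k i a) := fun i j a => by
    rw [AlgEquiv.eq_symm_apply, k_comm', AlgEquiv.apply_symm_apply]
  have ke' : ∀ i j a, k i (e j a) = q ^ cartan m i j • e j (k i a) := fun i j =>
    QSpace.twisted_ext (D := (k i).toLinearMap ∘ₗ e j)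
      (D' := q ^ cartan m i j • (e j ∘ₗ (k i).toLinearMap)) (L := k i)
      (R := fun b => k i (k j b)) (fun a b => by simp [e_mul])
      (fun a b => by simp [e_mul, k_comm' j i]) (by simp [e_one]) (ke i j)
  have kf' : ∀ i j a, k i (f j a) = q ^ (-cartan m i j) • f j (k i a) := fun i j =>
    QSpace.twisted_ext (D := (k i).toLinearMap ∘ₗ f j)
      (D' := q ^ (-cartan m i j) • (f j ∘ₗ (k i).toLinearMap)) (L := fun a => k i ((k j).symm a))
      (R := k i) (fun a b => by simp [f_mul])
      (fun a b => by simp [f_mul, k_symm_comm]) (by simp [f_one]) (kf i j)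
  have kf_symm : ∀ i j a, (k i).symm (f j a) = q ^ cartan m i j • f j ((k i).symm a) :=
    fun i j a => by
      rw [AlgEquiv.symm_apply_eq, map_smul, kf', smul_smul, ← zpow_add₀ hq]
      simp
  { k := k
    e := e
    f := f
    e_mul := e_mul
    f_mul := f_mul
    e_one := e_one
    f_one := f_one
    k_comm := k_comm'
    ke := fun i j a => by rw [ke', AlgEquiv.apply_symm_apply]
    kf := fun i j a => by rw [kf', AlgEquiv.apply_symm_apply]
    ef := fun i j a => by
      have hmul := commutator_mul_of_twisted hq (cartan m j i) (e_mul i) (f_mul j) (ke' j i)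
        (fun a => by rw [kf', cartan_comm])
      split_ifs with hij
      · subst hij
        refine QSpace.twisted_ext (D := e i ∘ₗ f i - f i ∘ₗ e i)
          (D' := (q - q⁻¹)⁻¹ • ((k i).toLinearMap - (k i).symm.toLinearMap)) hmul
          (fun a b => ?_) (by simp [e_one, f_one]) (fun s => by simpa using ef i i s) a
        simp only [LinearMap.smul_apply, LinearMap.sub_apply, AlgEquiv.toLinearMap_apply, map_mul,
          mul_smul_comm, smul_mul_assoc, mul_sub, sub_mul]
        module
      · refine QSpace.twisted_ext (D := e i ∘ₗ f j - f j ∘ₗ e i) (D' := 0) hmul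
          (by simp) (by simp [e_one, f_one]) (fun s => by simpa [hij] using ef i j s) a
    ee_comm := fun i j h => absurd h (hm i j)
    ff_comm := fun i j h => absurd h (hm i j)
    serre_e := fun i j hij =>
      have hji : cartan m j i = -1 := by rw [cartan_comm, hij]
      QSpace.twisted_ext
        (D := e i ∘ₗ e i ∘ₗ e j - (q + q⁻¹) • (e i ∘ₗ e j ∘ₗ e i) + e j ∘ₗ e i ∘ₗ e i)
        (D' := 0) (L := id) (R := fun b => k i (k i (k j b)))
        (serre_mul_of_right_twisted hq (e_mul i) (e_mul j) (k_comm' j i)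
          (fun a => by rw [ke', cartan_self]) (fun a => by rw [ke', hij])
          (fun a => by rw [ke', hji]))
        (by simp) (by simp [e_one]) (serre_e i j hij)
    serre_f := fun i j hij =>
      have hji : cartan m j i = -1 := by rw [cartan_comm, hij]
      QSpace.twisted_ext
        (D := f i ∘ₗ f i ∘ₗ f j - (q + q⁻¹) • (f i ∘ₗ f j ∘ₗ f i) + f j ∘ₗ f i ∘ₗ f i)
        (D' := 0) (L := fun a => (k i).symm ((k i).symm ((k j).symm a))) (R := id)
        (serre_mul_of_left_twisted hq (f_mul i) (f_mul j)
          (fun a => by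
            rw [AlgEquiv.symm_apply_eq, k_symm_comm, AlgEquiv.apply_symm_apply])
          (fun a => by rw [kf_symm, cartan_self]) (fun a => by rw [kf_symm, hij])
          (fun a => by rw [kf_symm, hji]))
        (by simp) (by simp [f_one]) (serre_f i j hij) }

/-! ### The monomial basis of `A_q(3)` -/

/-- The ordered monomial `x_1^a x_2^b x_3^c`. -/
def qmon (q : ℂ) (a b c : ℕ) : QSpace q 3 := Z1 q ^ a * Z2 q ^ b * Z3 q ^ c

lemma Z1_eq_qmon (q : ℂ) : Z1 q = qmon q 1 0 0 := by simp [qmon]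
lemma Z2_eq_qmon (q : ℂ) : Z2 q = qmon q 0 1 0 := by simp [qmon]
lemma Z3_eq_qmon (q : ℂ) : Z3 q = qmon q 0 0 1 := by simp [qmon]
lemma one_eq_qmon (q : ℂ) : 1 = qmon q 0 0 0 := by simp [qmon]

lemma pow_mul_pow_of_qcomm {A : Type} [Ring A] [Algebra ℂ A] {q : ℂ} {x y : A}
    (h : y * x = q • (x * y)) (m n : ℕ) : y ^ m * x ^ n = q ^ (m * n) • (x ^ n * y ^ m) := by
  have h1 : ∀ n : ℕ, y * x ^ n = q ^ n • (x ^ n * y) := fun n => by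
    induction n with
    | zero => simp
    | succ n ih =>
      rw [pow_succ, ← mul_assoc, ih, smul_mul_assoc, mul_assoc, h, mul_smul_comm, smul_smul,
        ← pow_succ, mul_assoc]
  induction m with
  | zero => simp
  | succ m ih =>
    rw [pow_succ, mul_assoc, h1, mul_smul_comm, ← mul_assoc, ih, smul_mul_assoc, smul_smul,
      ← pow_add, mul_assoc, ← pow_succ]
    congr 2
    ring

lemma qmon_mul (q : ℂ) (a b c a' b' c' : ℕ) :
    qmon q a b c * qmon q a' b' c' =
      q ^ (a' * (b + c) + b' * c) • qmon q (a + a') (b + b') (c + c') := by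
  have h21 := pow_mul_pow_of_qcomm (Xg_mul_Xg q 3 (i := 1) (j := 0) (by decide)) b a'
  have h31 := pow_mul_pow_of_qcomm (Xg_mul_Xg q 3 (i := 2) (j := 0) (by decide)) c a'
  have h32 := pow_mul_pow_of_qcomm (Xg_mul_Xg q 3 (i := 2) (j := 1) (by decide)) c b'
  simp only [qmon, Z1, Z2, Z3, pow_add]
  generalize Xg q 3 0 ^ a = A at *
  generalize Xg q 3 1 ^ b = B at *
  generalize Xg q 3 2 ^ c = C at *
  generalize Xg q 3 0 ^ a' = A' at *
  generalize Xg q 3 1 ^ b' = B' at *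
  generalize Xg q 3 2 ^ c' = C' at *
  calc A * B * C * (A' * B' * C') = A * B * (C * A') * B' * C' := by noncomm_ring
    _ = q ^ (c * a') • (A * (B * A') * (C * B') * C') := by rw [h31]; noncomm_ring
    _ = _ := by
      rw [h21, h32]
      simp only [smul_mul_assoc, mul_smul_comm, smul_smul, mul_assoc]
      congr 1
      ring

/-- Left multiplication by `x_1`, `x_2`, `x_3` in the monomial basis. -/
def qmonShift (q : ℂ) : Fin 3 → Module.End ℂ (ℕ × ℕ × ℕ →₀ ℂ) :=
  ![Finsupp.linearCombination ℂ fun m => Finsupp.single (m.1 + 1, m.2.1, m.2.2) 1,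
    Finsupp.linearCombination ℂ fun m => Finsupp.single (m.1, m.2.1 + 1, m.2.2) (q ^ m.1),
    Finsupp.linearCombination ℂ fun m =>
      Finsupp.single (m.1, m.2.1, m.2.2 + 1) (q ^ (m.1 + m.2.1))]

/-- The left regular representation of `A_q(3)` in the monomial basis. -/
def qmonRep (q : ℂ) : QSpace q 3 →ₐ[ℂ] Module.End ℂ (ℕ × ℕ × ℕ →₀ ℂ) :=
  QSpace.lift (qmonShift q) fun i j hij => by
    ext m : 2
    fin_cases i <;> fin_cases j <;> first
      | exact absurd hij (by decide)
      | (simp [qmonShift, -Finsupp.single_mul]; ring_nf)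

/-- The coordinates of an element of `A_q(3)` in the monomial basis. -/
def qcoeff (q : ℂ) : QSpace q 3 →ₗ[ℂ] (ℕ × ℕ × ℕ →₀ ℂ) :=
  (LinearMap.applyₗ (Finsupp.single (0, 0, 0) (1 : ℂ))) ∘ₗ (qmonRep q).toLinearMap

lemma qcoeff_qmon (q : ℂ) (a b c : ℕ) : qcoeff q (qmon q a b c) = Finsupp.single (a, b, c) 1 := by
  have h3 : ∀ c : ℕ, (qmonShift q 2 ^ c) (Finsupp.single (0, 0, 0) 1) =
      Finsupp.single (0, 0, c) 1 := fun c => by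
    induction c with
    | zero => simp
    | succ c ih => rw [pow_succ', Module.End.mul_apply, ih]; simp [qmonShift]
  have h2 : ∀ b : ℕ, (qmonShift q 1 ^ b) (Finsupp.single (0, 0, c) 1) =
      Finsupp.single (0, b, c) 1 := fun b => by
    induction b with
    | zero => simp
    | succ c ih => rw [pow_succ', Module.End.mul_apply, ih]; simp [qmonShift]
  have h1 : ∀ a : ℕ, (qmonShift q 0 ^ a) (Finsupp.single (0, b, c) 1) =
      Finsupp.single (a, b, c) 1 := fun a => by
    induction a with
    | zero => simp
    | succ c ih => rw [pow_succ', Module.End.mul_apply, ih]; simp [qmonShift]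
  simp [qcoeff, qmonRep, qmon, Z1, Z2, Z3, h1, h2, h3]

lemma linearCombination_qcoeff (q : ℂ) (a : QSpace q 3) :
    Finsupp.linearCombination ℂ (fun m : ℕ × ℕ × ℕ => qmon q m.1 m.2.1 m.2.2) (qcoeff q a) = a := by
  have key : ∀ a v, Finsupp.linearCombination ℂ
      (fun m : ℕ × ℕ × ℕ => qmon q m.1 m.2.1 m.2.2) (qmonRep q a v) =
      a * Finsupp.linearCombination ℂ (fun m : ℕ × ℕ × ℕ => qmon q m.1 m.2.1 m.2.2) v := by
    intro a
    induction a using QSpace.induction with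
    | smul_one c => simp
    | gen i =>
      intro v
      induction v using Finsupp.induction_linear with
      | zero => simp
      | add f g hf hg => rw [map_add, map_add, map_add, hf, hg, mul_add]
      | single m c =>
        have h1 := qmon_mul q 1 0 0 m.1 m.2.1 m.2.2
        have h2 := qmon_mul q 0 1 0 m.1 m.2.1 m.2.2
        have h3 := qmon_mul q 0 0 1 m.1 m.2.1 m.2.2
        rw [← Z1_eq_qmon, Z1] at h1
        rw [← Z2_eq_qmon, Z2] at h2
        rw [← Z3_eq_qmon, Z3] at h3
        fin_cases i <;>
          simp [qmonRep, qmonShift, h1, h2, h3, smul_smul, add_comm, -Finsupp.single_mul]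
    | mul a b ha hb => intro v; rw [map_mul, Module.End.mul_apply, ha, hb, mul_assoc]
    | add a b ha hb => intro v; rw [map_add, LinearMap.add_apply, map_add, ha, hb, add_mul]
  have := key a (Finsupp.single (0, 0, 0) 1)
  simpa [qcoeff, ← one_eq_qmon] using this

lemma eq_sum_qmon {q : ℂ} {a : QSpace q 3} {S : Finset (ℕ × ℕ × ℕ)}
    (hS : ∀ m, qcoeff q a m ≠ 0 → m ∈ S) :
    a = ∑ m ∈ S, qcoeff q a m • qmon q m.1 m.2.1 m.2.2 := by
  conv_lhs => rw [← linearCombination_qcoeff q a]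
  exact Finsupp.sum_of_support_subset _ (fun m hm => hS m (Finsupp.mem_support_iff.1 hm)) _
    (by simp)

lemma qcoeff_of_diagonal {q : ℂ} {φ : QSpace q 3 →ₗ[ℂ] QSpace q 3} {w : ℕ × ℕ × ℕ → ℂ}
    (hφ : ∀ a b c, φ (qmon q a b c) = w (a, b, c) • qmon q a b c) (a : QSpace q 3)
    (m : ℕ × ℕ × ℕ) : qcoeff q (φ a) m = w m * qcoeff q a m := by
  rw [← linearCombination_qcoeff q a]
  generalize qcoeff q a = v
  induction v using Finsupp.induction_linear with
  | zero => simp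
  | add f g hf hg => simp only [map_add, Finsupp.add_apply, hf, hg, mul_add]
  | single n c =>
    simp only [Finsupp.linearCombination_single, map_smul, hφ, qcoeff_qmon, Finsupp.smul_apply,
      smul_eq_mul]
    by_cases h : n = m
    · subst h; simp; ring
    · simp [Finsupp.single_eq_of_ne' h]

/-! ### Weights -/

lemma zpow_injective_of_not_root_of_unity {q : ℂ} (hq : q ≠ 0)
    (hq' : ∀ N : ℕ, 0 < N → q ^ N ≠ 1) : Function.Injective fun n : ℤ => q ^ n := by
  have h : ¬IsOfFinOrder (Units.mk0 q hq) := by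
    rw [isOfFinOrder_iff_pow_eq_one]
    rintro ⟨N, hN, h⟩
    exact hq' N hN (by simpa using congrArg Units.val h)
  intro a b hab
  exact (injective_zpow_iff_not_isOfFinOrder.2 h) (Units.ext (by simpa using hab))

lemma KCond14.weights {q : ℂ} (hq : q ≠ 0) (hq' : ∀ N : ℕ, 0 < N → q ^ N ≠ 1)
    {π : UqslMA q 2 (QSpace q 3)} (hπ : KCond14 q π) {a : QSpace q 3} {w₁ w₂ : ℤ}
    (h₁ : π.k 0 a = q ^ (-w₁) • a) (h₂ : π.k 1 a = q ^ w₂ • a) {m : ℕ × ℕ × ℕ}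
    (hm : qcoeff q a m ≠ 0) :
    2 * (m.1 : ℤ) + m.2.1 + m.2.2 = w₁ ∧ (m.1 : ℤ) + 2 * m.2.1 - m.2.2 = w₂ := by
  obtain ⟨k11, k12, k13, k21, k22, k23⟩ := hπ
  have inj := zpow_injective_of_not_root_of_unity hq hq'
  have e₁ := qcoeff_of_diagonal (q := q) (φ := (π.k 0).toLinearMap)
    (w := fun m => q ^ (-(2 * (m.1 : ℤ) + m.2.1 + m.2.2))) (fun a b c => by
      simp only [qmon, AlgEquiv.toLinearMap_apply, map_mul, map_pow, k11, k12, k13, smul_pow,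
        smul_mul_assoc, mul_smul_comm, smul_smul]
      congr 1
      rw [← zpow_neg_one, ← zpow_natCast, ← zpow_natCast, ← zpow_natCast, ← zpow_mul, ← zpow_mul,
        ← zpow_mul, ← zpow_add₀ hq, ← zpow_add₀ hq]
      congr 1
      ring) a m
  have e₂ := qcoeff_of_diagonal (q := q) (φ := (π.k 1).toLinearMap)
    (w := fun m => q ^ ((m.1 : ℤ) + 2 * m.2.1 - m.2.2)) (fun a b c => by
      simp only [qmon, AlgEquiv.toLinearMap_apply, map_mul, map_pow, k21, k22, k23, smul_pow,
        smul_mul_assoc, mul_smul_comm, smul_smul]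
      congr 1
      rw [← zpow_neg_one, ← pow_mul, ← zpow_natCast, ← zpow_natCast, ← zpow_natCast, ← zpow_mul,
        ← zpow_add₀ hq, ← zpow_add₀ hq]
      congr 1
      push_cast
      ring) a m
  rw [AlgEquiv.toLinearMap_apply, h₁, map_smul, Finsupp.smul_apply, smul_eq_mul] at e₁
  rw [AlgEquiv.toLinearMap_apply, h₂, map_smul, Finsupp.smul_apply, smul_eq_mul] at e₂
  have i₁ := inj (mul_right_cancel₀ hm e₁)
  have i₂ := inj (mul_right_cancel₀ hm e₂)
  exact ⟨by linarith, by linarith⟩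

lemma UqslMA.k_e {q : ℂ} {m : ℕ} {A : Type} [Ring A] [Algebra ℂ A] (π : UqslMA q m A)
    (i j : Fin m) (a : A) : π.k i (π.e j a) = q ^ cartan m i j • π.e j (π.k i a) := by
  simpa using π.ke i j (π.k i a)

lemma UqslMA.k_f {q : ℂ} {m : ℕ} {A : Type} [Ring A] [Algebra ℂ A] (π : UqslMA q m A)
    (i j : Fin m) (a : A) : π.k i (π.f j a) = q ^ (-cartan m i j) • π.f j (π.k i a) := by
  simpa using π.kf i j (π.k i a)

lemma KCond14.exists_k_Xg {q : ℂ} {π : UqslMA q 2 (QSpace q 3)} (hπ : KCond14 q π) (s : Fin 3) :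
    π.k 0 (Xg q 3 s) = q ^ (![-2, -1, -1] s : ℤ) • Xg q 3 s ∧
      π.k 1 (Xg q 3 s) = q ^ (![1, 2, -1] s : ℤ) • Xg q 3 s := by
  obtain ⟨k11, k12, k13, k21, k22, k23⟩ := hπ
  simp only [Z1, Z2, Z3] at *
  fin_cases s <;> simp [*]

lemma KCond14.symm {q : ℂ} (hq : q ≠ 0) {π : UqslMA q 2 (QSpace q 3)} (hπ : KCond14 q π) :
    (π.k 0).symm (Z1 q) = (q ^ 2) • Z1 q ∧ (π.k 0).symm (Z2 q) = q • Z2 q ∧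
    (π.k 0).symm (Z3 q) = q • Z3 q ∧ (π.k 1).symm (Z1 q) = q⁻¹ • Z1 q ∧
    (π.k 1).symm (Z2 q) = (q ^ 2)⁻¹ • Z2 q ∧ (π.k 1).symm (Z3 q) = q • Z3 q := by
  obtain ⟨k11, k12, k13, k21, k22, k23⟩ := hπ
  refine ⟨?_, ?_, ?_, ?_, ?_, ?_⟩ <;> rw [AlgEquiv.symm_apply_eq, map_smul]
  · rw [k11, smul_smul, zpow_neg]; norm_cast; simp [hq]
  · rw [k12, smul_smul]; simp [hq]
  · rw [k13, smul_smul]; simp [hq]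
  · rw [k21, smul_smul]; simp [hq]
  · rw [k22, smul_smul]; simp [hq]
  · rw [k23, smul_smul]; simp [hq]

/-- Expansion of `e_j(x_s)` over any finite set of monomials that contains those of its weight. -/
lemma KCond14.e_Xg_eq_sum {q : ℂ} (hq : q ≠ 0) (hq' : ∀ N : ℕ, 0 < N → q ^ N ≠ 1)
    {π : UqslMA q 2 (QSpace q 3)} (hπ : KCond14 q π) (j : Fin 2) (s : Fin 3)
    (S : Finset (ℕ × ℕ × ℕ))
    (hS : ∀ a b c : ℕ, 2 * (a : ℤ) + b + c = -(cartan 2 0 j + ![-2, -1, -1] s) →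
      (a : ℤ) + 2 * b - c = cartan 2 1 j + ![1, 2, -1] s → (a, b, c) ∈ S) :
    ∃ r : ℕ × ℕ × ℕ → ℂ, π.e j (Xg q 3 s) = ∑ m ∈ S, r m • qmon q m.1 m.2.1 m.2.2 := by
  obtain ⟨h₁, h₂⟩ := hπ.exists_k_Xg s
  refine ⟨_, eq_sum_qmon fun m hm => ?_⟩
  have := hπ.weights hq hq' (w₁ := -(cartan 2 0 j + ![-2, -1, -1] s))
    (w₂ := cartan 2 1 j + ![1, 2, -1] s)
    (by rw [π.k_e, h₁, map_smul, smul_smul, ← zpow_add₀ hq, neg_neg])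
    (by rw [π.k_e, h₂, map_smul, smul_smul, ← zpow_add₀ hq]) hm
  exact hS _ _ _ this.1 this.2

/-- Expansion of `f_j(x_s)` over any finite set of monomials that contains those of its weight. -/
lemma KCond14.f_Xg_eq_sum {q : ℂ} (hq : q ≠ 0) (hq' : ∀ N : ℕ, 0 < N → q ^ N ≠ 1)
    {π : UqslMA q 2 (QSpace q 3)} (hπ : KCond14 q π) (j : Fin 2) (s : Fin 3)
    (S : Finset (ℕ × ℕ × ℕ))
    (hS : ∀ a b c : ℕ, 2 * (a : ℤ) + b + c = -(-cartan 2 0 j + ![-2, -1, -1] s) →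
      (a : ℤ) + 2 * b - c = -cartan 2 1 j + ![1, 2, -1] s → (a, b, c) ∈ S) :
    ∃ r : ℕ × ℕ × ℕ → ℂ, π.f j (Xg q 3 s) = ∑ m ∈ S, r m • qmon q m.1 m.2.1 m.2.2 := by
  obtain ⟨h₁, h₂⟩ := hπ.exists_k_Xg s
  refine ⟨_, eq_sum_qmon fun m hm => ?_⟩
  have := hπ.weights hq hq' (w₁ := -(-cartan 2 0 j + ![-2, -1, -1] s))
    (w₂ := -cartan 2 1 j + ![1, 2, -1] s)
    (by rw [π.k_f, h₁, map_smul, smul_smul, ← zpow_add₀ hq, neg_neg])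
    (by rw [π.k_f, h₂, map_smul, smul_smul, ← zpow_add₀ hq]) hm
  exact hS _ _ _ this.1 this.2

/-- The general form of the `e`/`f`-action forced by the weights alone. -/
lemma KCond14.weight_form {q : ℂ} (hq : q ≠ 0) (hq' : ∀ N : ℕ, 0 < N → q ^ N ≠ 1)
    {π : UqslMA q 2 (QSpace q 3)} (hπ : KCond14 q π) :
    (∃ a : ℂ, π.e 0 (Z1 q) = a • 1) ∧ π.e 0 (Z2 q) = 0 ∧ π.e 0 (Z3 q) = 0 ∧
    (∃ a b : ℂ, π.e 1 (Z1 q) = a • (Z1 q * Z2 q) + b • (Z2 q * Z2 q * Z3 q)) ∧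
    (∃ a : ℂ, π.e 1 (Z2 q) = a • (Z2 q * Z2 q)) ∧
    (∃ a b : ℂ, π.e 1 (Z3 q) = a • Z1 q + b • (Z2 q * Z3 q)) ∧
    (∃ a b c : ℂ, π.f 0 (Z1 q) = a • (Z1 q * Z1 q) + b • (Z1 q * Z2 q * Z3 q) +
      c • (Z2 q * Z2 q * Z3 q * Z3 q)) ∧
    (∃ a b : ℂ, π.f 0 (Z2 q) = a • (Z1 q * Z2 q) + b • (Z2 q * Z2 q * Z3 q)) ∧
    (∃ a b : ℂ, π.f 0 (Z3 q) = a • (Z1 q * Z3 q) + b • (Z2 q * Z3 q * Z3 q)) ∧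
    (∃ a : ℂ, π.f 1 (Z1 q) = a • Z3 q) ∧ (∃ a : ℂ, π.f 1 (Z2 q) = a • 1) ∧ π.f 1 (Z3 q) = 0 := by
  refine ⟨?_, ?_, ?_, ?_, ?_, ?_, ?_, ?_, ?_, ?_, ?_, ?_⟩
  · obtain ⟨r, h⟩ := hπ.e_Xg_eq_sum hq hq' 0 0 {(0, 0, 0)}
      (by intro a b c; simp [cartan]; omega)
    exact ⟨r (0, 0, 0), by simp [Z1, h, ← one_eq_qmon]⟩
  · obtain ⟨r, h⟩ := hπ.e_Xg_eq_sum hq hq' 0 1 ∅ (by intro a b c; simp [cartan]; omega)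
    rw [Z2, h, Finset.sum_empty]
  · obtain ⟨r, h⟩ := hπ.e_Xg_eq_sum hq hq' 0 2 ∅ (by intro a b c; simp [cartan]; omega)
    rw [Z3, h, Finset.sum_empty]
  · obtain ⟨r, h⟩ := hπ.e_Xg_eq_sum hq hq' 1 0 {(1, 1, 0), (0, 2, 1)}
      (by intro a b c; simp [cartan]; omega)
    exact ⟨r (1, 1, 0), r (0, 2, 1), by rw [Z1, h]; simp [qmon, Z1, pow_two, mul_assoc]⟩
  · obtain ⟨r, h⟩ := hπ.e_Xg_eq_sum hq hq' 1 1 {(0, 2, 0)}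
      (by intro a b c; simp [cartan]; omega)
    exact ⟨r (0, 2, 0), by rw [Z2, h]; simp [qmon, Z2, pow_two, mul_assoc]⟩
  · obtain ⟨r, h⟩ := hπ.e_Xg_eq_sum hq hq' 1 2 {(1, 0, 0), (0, 1, 1)}
      (by intro a b c; simp [cartan]; omega)
    exact ⟨r (1, 0, 0), r (0, 1, 1), by rw [Z3, h]; simp [qmon, Z3, mul_assoc]⟩
  · obtain ⟨r, h⟩ := hπ.f_Xg_eq_sum hq hq' 0 0 {(2, 0, 0), (1, 1, 1), (0, 2, 2)}
      (by intro a b c; simp [cartan]; omega)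
    exact ⟨r (2, 0, 0), r (1, 1, 1), r (0, 2, 2), by
      rw [Z1, h]; simp [qmon, Z1, pow_two, mul_assoc, add_assoc]⟩
  · obtain ⟨r, h⟩ := hπ.f_Xg_eq_sum hq hq' 0 1 {(1, 1, 0), (0, 2, 1)}
      (by intro a b c; simp [cartan]; omega)
    exact ⟨r (1, 1, 0), r (0, 2, 1), by rw [Z2, h]; simp [qmon, Z2, pow_two, mul_assoc]⟩
  · obtain ⟨r, h⟩ := hπ.f_Xg_eq_sum hq hq' 0 2 {(1, 0, 1), (0, 1, 2)}
      (by intro a b c; simp [cartan]; omega)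
    exact ⟨r (1, 0, 1), r (0, 1, 2), by rw [Z3, h]; simp [qmon, Z3, pow_two, mul_assoc]⟩
  · obtain ⟨r, h⟩ := hπ.f_Xg_eq_sum hq hq' 1 0 {(0, 0, 1)}
      (by intro a b c; simp [cartan]; omega)
    exact ⟨r (0, 0, 1), by rw [Z1, h]; simp [qmon]⟩
  · obtain ⟨r, h⟩ := hπ.f_Xg_eq_sum hq hq' 1 1 {(0, 0, 0)}
      (by intro a b c; simp [cartan]; omega)
    exact ⟨r (0, 0, 0), by rw [Z2, h]; simp [qmon]⟩
  · obtain ⟨r, h⟩ := hπ.f_Xg_eq_sum hq hq' 1 2 ∅ (by intro a b c; simp [cartan]; omega)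
    rw [Z3, h, Finset.sum_empty]

lemma Z2_mul_Z1 (q : ℂ) : Z2 q * Z1 q = q • (Z1 q * Z2 q) := Xg_mul_Xg q 3 (by decide)

lemma KCond14.description {q : ℂ} (hq : q ≠ 0) (hq' : ∀ N : ℕ, 0 < N → q ^ N ≠ 1)
    {π : UqslMA q 2 (QSpace q 3)} (hπ : KCond14 q π) :
    ∃ a₀ e₀ a₃ ξ₄ : ℂ, a₀ ≠ 0 ∧ e₀ ≠ 0 ∧ a₃ ≠ 0 ∧ ξ₄ ≠ 0 ∧
        a₃ * ξ₄ = -q * e₀⁻¹ * a₀⁻¹ ∧ EFDesc14 q π a₀ e₀ a₃ ξ₄ := by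
  have hq2 : q ^ 2 - 1 ≠ 0 := sub_ne_zero.2 (hq' 2 (by norm_num))
  have hq4 : q ^ 2 + 1 ≠ 0 := fun h => hq' 4 (by norm_num) (by linear_combination (q ^ 2 - 1) * h)
  have hqq : q - q⁻¹ ≠ 0 := fun h => hq2 (by field_simp at h; simpa using h)
  have hinv : (q - q⁻¹)⁻¹ = q / (q ^ 2 - 1) := by field_simp
  have ⟨⟨a₀, e11⟩, e12, e13, ⟨α, β, e21⟩, ⟨γ, e22⟩, ⟨a₃, δ, e23⟩, ⟨A, B, C, f11⟩, ⟨D, E, f12⟩,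
    ⟨G, ξ, f13⟩, ⟨μ, f21⟩, ⟨e₀, f22⟩, f23⟩ := hπ.weight_form hq hq'
  have ⟨k11, k12, k13, k21, k22, k23⟩ := hπ
  rw [show q ^ (-2 : ℤ) = (q ^ 2)⁻¹ by simp [zpow_neg]] at k11
  have ⟨l11, l12, l13, l21, l22, l23⟩ := hπ.symm hq
  have hμ : μ = 0 := by
    have h := congrArg (π.f 1) (Z2_mul_Z1 q)
    simp only [map_smul, π.f_mul, l21, l22, f21, f22] at h
    replace h := congrArg (fun a => qcoeff q a (0, 1, 1)) h
    simp [Z1_eq_qmon, Z2_eq_qmon, Z3_eq_qmon, one_eq_qmon, qmon_mul, qcoeff_qmon] at h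
    field_simp at h
    grind
  subst hμ
  have hC : C = 0 := by
    have h := congrArg (π.f 0) (Z2_mul_Z1 q)
    simp only [map_smul, π.f_mul, l11, l12, f11, f12] at h
    replace h := congrArg (fun a => qcoeff q a (0, 3, 2)) h
    simp [Z1_eq_qmon, Z2_eq_qmon, Z3_eq_qmon, qmon_mul, qcoeff_qmon, mul_add, add_mul] at h
    field_simp at h
    grind
  subst hC
  have hA : A * a₀ = -q := by
    have h := π.ef 0 0 (Z1 q)
    simp only [map_add, map_smul, smul_zero, π.e_mul, e11, e12, e13, f11, k11, k12, k13, l11,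
      π.f_one, if_true, hinv] at h
    replace h := congrArg (fun a => qcoeff q a (1, 0, 0)) h
    simp [Z1_eq_qmon, Z2_eq_qmon, Z3_eq_qmon, one_eq_qmon, qmon_mul, qcoeff_qmon] at h
    field_simp at h
    grind
  have ha₀ : a₀ ≠ 0 := by rintro rfl; simp [hq] at hA
  have hB : B = 0 := by
    have h := π.ef 0 0 (Z1 q)
    simp only [map_add, map_smul, smul_zero, π.e_mul, e11, e12, e13, f11, k11, k12, k13, l11,
      π.f_one, if_true, hinv] at h
    replace h := congrArg (fun a => qcoeff q a (0, 1, 1)) h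
    simp [Z1_eq_qmon, Z2_eq_qmon, Z3_eq_qmon, one_eq_qmon, qmon_mul, qcoeff_qmon] at h
    field_simp at h
    grind
  subst hB
  have hD : D * a₀ = -q := by
    have h := π.ef 0 0 (Z2 q)
    simp only [map_add, map_smul, map_zero, π.e_mul, e11, e12, e13, f12, k12, k13, l12, if_true,
      hinv] at h
    replace h := congrArg (fun a => qcoeff q a (0, 1, 0)) h
    simp [Z1_eq_qmon, Z2_eq_qmon, Z3_eq_qmon, one_eq_qmon, qmon_mul, qcoeff_qmon] at h
    field_simp at h
    grind
  have hG : G * a₀ = -q := by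
    have h := π.ef 0 0 (Z3 q)
    simp only [map_add, map_smul, map_zero, π.e_mul, e11, e12, e13, f13, k13, l13, if_true,
      hinv] at h
    replace h := congrArg (fun a => qcoeff q a (0, 0, 1)) h
    simp [Z1_eq_qmon, Z2_eq_qmon, Z3_eq_qmon, one_eq_qmon, qmon_mul, qcoeff_qmon] at h
    field_simp at h
    grind
  have hγ : γ * e₀ = -q := by
    have h := π.ef 1 1 (Z2 q)
    simp only [map_smul, smul_zero, π.f_mul, f22, l22, π.e_one, e22, k22, if_true, hinv] at h
    replace h := congrArg (fun a => qcoeff q a (0, 1, 0)) h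
    simp [Z2_eq_qmon, one_eq_qmon, qmon_mul, qcoeff_qmon] at h
    field_simp at h
    grind
  have he₀ : e₀ ≠ 0 := by rintro rfl; simp [hq] at hγ
  have hα : α * e₀ = -q := by
    have h := π.ef 1 1 (Z1 q)
    simp only [map_add, map_smul, π.f_mul, f21, f22, f23, l21, l22, e21, k21, if_true, hinv] at h
    replace h := congrArg (fun a => qcoeff q a (1, 0, 0)) h
    simp [Z1_eq_qmon, Z2_eq_qmon, Z3_eq_qmon, one_eq_qmon, qmon_mul, qcoeff_qmon, add_mul] at h
    field_simp at h
    grind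
  have hβ : β = 0 := by
    have h := π.ef 1 1 (Z1 q)
    simp only [map_add, map_smul, π.f_mul, f21, f22, f23, l21, l22, e21, k21, if_true, hinv] at h
    replace h := congrArg (fun a => qcoeff q a (0, 1, 1)) h
    simp [Z1_eq_qmon, Z2_eq_qmon, Z3_eq_qmon, one_eq_qmon, qmon_mul, qcoeff_qmon, add_mul] at h
    field_simp at h
    grind
  subst hβ
  have hδ : δ * e₀ = 1 := by
    have h := π.ef 1 1 (Z3 q)
    simp only [map_add, map_smul, map_zero, π.f_mul, f21, f22, f23, l22, l23, e23, k23, if_true,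
      hinv] at h
    replace h := congrArg (fun a => qcoeff q a (0, 0, 1)) h
    simp [Z2_eq_qmon, Z3_eq_qmon, one_eq_qmon, qmon_mul, qcoeff_qmon] at h
    field_simp at h
    grind
  have hE : E = 0 := by
    have h := π.ef 1 0 (Z2 q)
    simp only [map_add, map_smul, π.f_mul, π.e_mul, f12, l12, e21, e22, e23, k22, k23] at h
    replace h := congrArg (fun a => qcoeff q a (0, 3, 1)) h
    simp [Z1_eq_qmon, Z2_eq_qmon, Z3_eq_qmon, qmon_mul, qcoeff_qmon, mul_add, add_mul] at h
    field_simp at h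
    grind
  subst hE
  have hξ : ξ * a₃ = δ * D := by
    have h := π.ef 1 0 (Z3 q)
    simp only [map_add, map_smul, π.f_mul, π.e_mul, f11, f12, f13, l12, e21, e22, e23, k23] at h
    replace h := congrArg (fun a => qcoeff q a (1, 1, 1)) h
    simp [Z1_eq_qmon, Z2_eq_qmon, Z3_eq_qmon, qmon_mul, qcoeff_qmon, mul_add, add_mul] at h
    field_simp at h
    grind
  have hα' : α = -q * e₀⁻¹ := by rw [← hα, mul_inv_cancel_right₀ he₀]
  have hγ' : γ = -q * e₀⁻¹ := by rw [← hγ, mul_inv_cancel_right₀ he₀]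
  have hδ' : δ = e₀⁻¹ := eq_inv_of_mul_eq_one_left hδ
  have hA' : A = -q * a₀⁻¹ := by rw [← hA, mul_inv_cancel_right₀ ha₀]
  have hD' : D = -q * a₀⁻¹ := by rw [← hD, mul_inv_cancel_right₀ ha₀]
  have hG' : G = -q * a₀⁻¹ := by rw [← hG, mul_inv_cancel_right₀ ha₀]
  have hprod : a₃ * ξ = -q * e₀⁻¹ * a₀⁻¹ := by rw [mul_comm, hξ, hδ', hD']; ring
  have hne : a₃ * ξ ≠ 0 := by rw [hprod]; simp [hq, he₀, ha₀]
  refine ⟨a₀, e₀, a₃, ξ, ha₀, he₀, left_ne_zero_of_mul hne, right_ne_zero_of_mul hne, hprod,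
    e11, e12, e13, ?_, ?_, ?_, ?_, ?_, ?_, ?_, f22, f23⟩
  · simp [e21, hα']
  · simp [e22, hγ', pow_two]
  · simp [e23, hδ']
  · simp [f11, hA', pow_two]
  · simp [f12, hD']
  · simp [f13, hG', pow_two, mul_assoc]
  · simp [f21]

/-! ### Isomorphism with the normalized structure -/

/-- An automorphism intertwining two structures on the generators is an isomorphism. -/
lemma UqslMA.Iso.of_generators {q : ℂ} {m n : ℕ} {π π' : UqslMA q m (QSpace q n)}
    (ψ : QSpace q n ≃ₐ[ℂ] QSpace q n)
    (hk : ∀ i s, ψ (π.k i (Xg q n s)) = π'.k i (ψ (Xg q n s)))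
    (he : ∀ i s, ψ (π.e i (Xg q n s)) = π'.e i (ψ (Xg q n s)))
    (hf : ∀ i s, ψ (π.f i (Xg q n s)) = π'.f i (ψ (Xg q n s))) : π.Iso π' := by
  have hk' : ∀ i a, ψ (π.k i a) = π'.k i (ψ a) := fun i =>
    QSpace.algHom_ext_apply (φ := ((π.k i).trans ψ).toAlgHom)
      (ψ := (ψ.trans (π'.k i)).toAlgHom) (hk i)
  have hk_symm : ∀ i a, ψ ((π.k i).symm a) = (π'.k i).symm (ψ a) := fun i a => by
    rw [AlgEquiv.eq_symm_apply, ← hk', AlgEquiv.apply_symm_apply]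
  have he' : ∀ i a, ψ (π.e i a) = π'.e i (ψ a) := fun i =>
    QSpace.twisted_ext (D := ψ.toLinearMap ∘ₗ π.e i) (D' := π'.e i ∘ₗ ψ.toLinearMap) (L := ψ)
      (R := fun b => ψ (π.k i b)) (fun a b => by simp [π.e_mul])
      (fun a b => by simp [π'.e_mul, hk']) (by simp [π.e_one, π'.e_one]) (he i)
  have hf' : ∀ i a, ψ (π.f i a) = π'.f i (ψ a) := fun i =>
    QSpace.twisted_ext (D := ψ.toLinearMap ∘ₗ π.f i) (D' := π'.f i ∘ₗ ψ.toLinearMap)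
      (L := fun a => ψ ((π.k i).symm a)) (R := ψ) (fun a b => by simp [π.f_mul])
      (fun a b => by simp [π'.f_mul, hk_symm]) (by simp [π.f_one, π'.f_one]) (hf i)
  exact ⟨ψ, fun i a => by rw [hk', AlgEquiv.apply_symm_apply],
    fun i a => by rw [hk_symm, AlgEquiv.apply_symm_apply],
    fun i a => by rw [he', AlgEquiv.apply_symm_apply],
    fun i a => by rw [hf', AlgEquiv.apply_symm_apply]⟩

lemma forall_fin_three {P : Fin 3 → Prop} (h0 : P 0) (h1 : P 1) (h2 : P 2) (s : Fin 3) : P s := by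
  fin_cases s <;> assumption

lemma KCond14.iso_of_EFDesc14 {q : ℂ} {π π' : UqslMA q 2 (QSpace q 3)}
    (hπ : KCond14 q π) (hπ' : KCond14 q π') {a₀ e₀ a₃ ξ₄ : ℂ} (ha₀ : a₀ ≠ 0) (he₀ : e₀ ≠ 0)
    (ha₃ : a₃ ≠ 0) (hξ : a₃ * ξ₄ = -q * e₀⁻¹ * a₀⁻¹) (h : EFDesc14 q π a₀ e₀ a₃ ξ₄)
    (h' : EFDesc14 q π' 1 1 1 (-q)) : π.Iso π' := by
  obtain ⟨k11, k12, k13, k21, k22, k23⟩ := hπ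
  obtain ⟨k11', k12', k13', k21', k22', k23'⟩ := hπ'
  obtain ⟨e11, e12, e13, e21, e22, e23, f11, f12, f13, f21, f22, f23⟩ := h
  obtain ⟨e11', e12', e13', e21', e22', e23', f11', f12', f13', f21', f22', f23'⟩ := h'
  let c : Fin 3 → ℂˣ := ![Units.mk0 a₀ ha₀, Units.mk0 e₀ he₀, Units.mk0 (a₃ * a₀) (by simp [*])]
  have s1 : QSpace.scale c (Z1 q) = a₀ • Z1 q := QSpace.scale_Xg c 0
  have s2 : QSpace.scale c (Z2 q) = e₀ • Z2 q := QSpace.scale_Xg c 1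
  have s3 : QSpace.scale c (Z3 q) = (a₃ * a₀) • Z3 q := QSpace.scale_Xg c 2
  have hξ' : ξ₄ = -q * e₀⁻¹ * a₀⁻¹ * a₃⁻¹ := by rw [← hξ]; field_simp
  simp only [Z1, Z2, Z3] at *
  refine UqslMA.Iso.of_generators (QSpace.scale c) ?_ ?_ ?_ <;> rw [Fin.forall_fin_two] <;>
    refine ⟨forall_fin_three ?_ ?_ ?_, forall_fin_three ?_ ?_ ?_⟩ <;>
    simp only [*, map_add, map_smul, map_mul, map_pow, map_one, map_zero, smul_mul_assoc,
      mul_smul_comm, smul_pow, smul_add, smul_zero, smul_smul] <;>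
    match_scalars <;> field_simp

/-! ### Existence -/

lemma forall_lt_fin_three {P : Fin 3 → Fin 3 → Prop} (h10 : P 1 0) (h20 : P 2 0) (h21 : P 2 1)
    (i j : Fin 3) (hij : j < i) : P i j := by
  fin_cases i <;> fin_cases j <;> first | assumption | exact absurd hij (by decide)

set_option maxHeartbeats 4000000 in
lemma exists_EFDesc14 {q : ℂ} (hq : q ≠ 0) (hq' : ∀ N : ℕ, 0 < N → q ^ N ≠ 1) {a₀ e₀ a₃ ξ₄ : ℂ}
    (ha₀ : a₀ ≠ 0) (he₀ : e₀ ≠ 0) (ha₃ : a₃ ≠ 0) (hξ : a₃ * ξ₄ = -q * e₀⁻¹ * a₀⁻¹) :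
    ∃ π : UqslMA q 2 (QSpace q 3), KCond14 q π ∧ EFDesc14 q π a₀ e₀ a₃ ξ₄ := by
  have hq2 : q ^ 2 - 1 ≠ 0 := sub_ne_zero.2 (hq' 2 (by norm_num))
  have hqq : q - q⁻¹ ≠ 0 := fun h => hq2 (by field_simp at h; simpa using h)
  have hinv : (q - q⁻¹)⁻¹ = q / (q ^ 2 - 1) := by field_simp
  have hξ' : ξ₄ = -q * e₀⁻¹ * a₀⁻¹ * a₃⁻¹ := by rw [← hξ]; field_simp
  let Q : ℂˣ := Units.mk0 q hq
  let c₁ : Fin 3 → ℂˣ := ![(Q ^ 2)⁻¹, Q⁻¹, Q⁻¹]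
  let c₂ : Fin 3 → ℂˣ := ![Q, Q ^ 2, Q⁻¹]
  obtain ⟨k₁, hk₁⟩ : ∃ k, k = QSpace.scale (q := q) c₁ := ⟨_, rfl⟩
  obtain ⟨k₂, hk₂⟩ : ∃ k, k = QSpace.scale (q := q) c₂ := ⟨_, rfl⟩
  have k11 : k₁ (Xg q 3 0) = (q ^ 2)⁻¹ • Xg q 3 0 := by simp [hk₁, c₁, Q]
  have k12 : k₁ (Xg q 3 1) = q⁻¹ • Xg q 3 1 := by simp [hk₁, c₁, Q]
  have k13 : k₁ (Xg q 3 2) = q⁻¹ • Xg q 3 2 := by simp [hk₁, c₁, Q]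
  have k21 : k₂ (Xg q 3 0) = q • Xg q 3 0 := by simp [hk₂, c₂, Q]
  have k22 : k₂ (Xg q 3 1) = q ^ 2 • Xg q 3 1 := by simp [hk₂, c₂, Q]
  have k23 : k₂ (Xg q 3 2) = q⁻¹ • Xg q 3 2 := by simp [hk₂, c₂, Q]
  have l11 : k₁.symm (Xg q 3 0) = q ^ 2 • Xg q 3 0 := by simp [hk₁, c₁, Q]
  have l12 : k₁.symm (Xg q 3 1) = q • Xg q 3 1 := by simp [hk₁, c₁, Q]
  have l13 : k₁.symm (Xg q 3 2) = q • Xg q 3 2 := by simp [hk₁, c₁, Q]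
  have l21 : k₂.symm (Xg q 3 0) = q⁻¹ • Xg q 3 0 := by simp [hk₂, c₂, Q]
  have l22 : k₂.symm (Xg q 3 1) = (q ^ 2)⁻¹ • Xg q 3 1 := by simp [hk₂, c₂, Q]
  have l23 : k₂.symm (Xg q 3 2) = q • Xg q 3 2 := by simp [hk₂, c₂, Q]
  have x21 := Xg_mul_Xg q 3 (i := 1) (j := 0) (by decide)
  have x31 := Xg_mul_Xg q 3 (i := 2) (j := 0) (by decide)
  have x32 := Xg_mul_Xg q 3 (i := 2) (j := 1) (by decide)
  have x21' : ∀ w, Xg q 3 1 * (Xg q 3 0 * w) = q • (Xg q 3 0 * (Xg q 3 1 * w)) := fun w => by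
    rw [← mul_assoc, x21, smul_mul_assoc, mul_assoc]
  have x31' : ∀ w, Xg q 3 2 * (Xg q 3 0 * w) = q • (Xg q 3 0 * (Xg q 3 2 * w)) := fun w => by
    rw [← mul_assoc, x31, smul_mul_assoc, mul_assoc]
  have x32' : ∀ w, Xg q 3 2 * (Xg q 3 1 * w) = q • (Xg q 3 1 * (Xg q 3 2 * w)) := fun w => by
    rw [← mul_assoc, x32, smul_mul_assoc, mul_assoc]
  obtain ⟨E₁, hE₁, E₁_one, E₁_mul⟩ := QSpace.exists_twisted (AlgHom.id ℂ _) k₁.toAlgHom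
    ![a₀ • 1, 0, 0] (by
      refine forall_lt_fin_three ?_ ?_ ?_ <;> simp [k11, k12, k13, smul_smul] <;>
      match_scalars <;> field_simp)
  obtain ⟨E₂, hE₂, E₂_one, E₂_mul⟩ := QSpace.exists_twisted (AlgHom.id ℂ _) k₂.toAlgHom
    ![(-q * e₀⁻¹) • (Xg q 3 0 * Xg q 3 1), (-q * e₀⁻¹) • (Xg q 3 1 * Xg q 3 1),
      a₃ • Xg q 3 0 + e₀⁻¹ • (Xg q 3 1 * Xg q 3 2)] (by
      refine forall_lt_fin_three ?_ ?_ ?_ <;>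
      simp [k21, k22, k23, x21, x31, x32, x21', x31', x32', mul_assoc, mul_add, add_mul, smul_smul,
        -mul_eq_mul_left_iff, -mul_eq_mul_right_iff] <;>
      match_scalars <;> field_simp <;> ring)
  obtain ⟨F₁, hF₁, F₁_one, F₁_mul⟩ := QSpace.exists_twisted k₁.symm.toAlgHom (AlgHom.id ℂ _)
    ![(-q * a₀⁻¹) • (Xg q 3 0 * Xg q 3 0), (-q * a₀⁻¹) • (Xg q 3 0 * Xg q 3 1),
      (-q * a₀⁻¹) • (Xg q 3 0 * Xg q 3 2) + ξ₄ • (Xg q 3 1 * Xg q 3 2 * Xg q 3 2)] (by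
      refine forall_lt_fin_three ?_ ?_ ?_ <;>
      simp [l11, l12, l13, x21, x31, x32, x21', x31', x32', mul_assoc, mul_add, add_mul,
        smul_smul] <;>
      match_scalars <;> field_simp)
  obtain ⟨F₂, hF₂, F₂_one, F₂_mul⟩ := QSpace.exists_twisted k₂.symm.toAlgHom (AlgHom.id ℂ _)
    ![0, e₀ • 1, 0] (by
      refine forall_lt_fin_three ?_ ?_ ?_ <;> simp [l21, l22, l23, smul_smul] <;>
      match_scalars <;> field_simp)
  have e11 : E₁ (Xg q 3 0) = a₀ • 1 := hE₁ 0
  have e12 : E₁ (Xg q 3 1) = 0 := hE₁ 1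
  have e13 : E₁ (Xg q 3 2) = 0 := hE₁ 2
  have e21 : E₂ (Xg q 3 0) = (-q * e₀⁻¹) • (Xg q 3 0 * Xg q 3 1) := hE₂ 0
  have e22 : E₂ (Xg q 3 1) = (-q * e₀⁻¹) • (Xg q 3 1 * Xg q 3 1) := hE₂ 1
  have e23 : E₂ (Xg q 3 2) = a₃ • Xg q 3 0 + e₀⁻¹ • (Xg q 3 1 * Xg q 3 2) := hE₂ 2
  have f11 : F₁ (Xg q 3 0) = (-q * a₀⁻¹) • (Xg q 3 0 * Xg q 3 0) := hF₁ 0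
  have f12 : F₁ (Xg q 3 1) = (-q * a₀⁻¹) • (Xg q 3 0 * Xg q 3 1) := hF₁ 1
  have f13 : F₁ (Xg q 3 2) = (-q * a₀⁻¹) • (Xg q 3 0 * Xg q 3 2) +
    ξ₄ • (Xg q 3 1 * Xg q 3 2 * Xg q 3 2) := hF₁ 2
  have f21 : F₂ (Xg q 3 0) = 0 := hF₂ 0
  have f22 : F₂ (Xg q 3 1) = e₀ • 1 := hF₂ 1
  have f23 : F₂ (Xg q 3 2) = 0 := hF₂ 2
  replace E₁_mul : ∀ a b, E₁ (a * b) = a * E₁ b + E₁ a * k₁ b := E₁_mul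
  replace E₂_mul : ∀ a b, E₂ (a * b) = a * E₂ b + E₂ a * k₂ b := E₂_mul
  replace F₁_mul : ∀ a b, F₁ (a * b) = k₁.symm a * F₁ b + F₁ a * b := F₁_mul
  replace F₂_mul : ∀ a b, F₂ (a * b) = k₂.symm a * F₂ b + F₂ a * b := F₂_mul
  clear hE₁ hE₂ hF₁ hF₂ hk₁ hk₂
  have c00 : cartan 2 0 0 = 2 := rfl
  have c01 : cartan 2 0 1 = -1 := rfl
  have c10 : cartan 2 1 0 = -1 := rfl
  have c11 : cartan 2 1 1 = 2 := rfl
  refine ⟨UqslMA.ofGenerators hq (by decide) ![k₁, k₂] ![E₁, E₂] ![F₁, F₂]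
    (Fin.forall_fin_two.2 ⟨E₁_mul, E₂_mul⟩) (Fin.forall_fin_two.2 ⟨F₁_mul, F₂_mul⟩)
    (Fin.forall_fin_two.2 ⟨E₁_one, E₂_one⟩) (Fin.forall_fin_two.2 ⟨F₁_one, F₂_one⟩)
    ?_ ?_ ?_ ?_ ?_ ?_, ?_, ?_⟩
  · simp only [Fin.forall_fin_two]
    refine ⟨⟨forall_fin_three ?_ ?_ ?_, forall_fin_three ?_ ?_ ?_⟩,
      forall_fin_three ?_ ?_ ?_, forall_fin_three ?_ ?_ ?_⟩ <;>
    simp [k11, k12, k13, k21, k22, k23, smul_smul, mul_comm]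
  · simp only [Fin.forall_fin_two, c00, c01, c10, c11, Matrix.cons_val_zero, Matrix.cons_val_one]
    refine ⟨⟨forall_fin_three ?_ ?_ ?_, forall_fin_three ?_ ?_ ?_⟩,
      forall_fin_three ?_ ?_ ?_, forall_fin_three ?_ ?_ ?_⟩ <;>
    simp only [k11, k12, k13, k21, k22, k23, e11, e12, e13, e21, e22, e23, map_add, map_smul,
      map_mul, map_one, map_zero, smul_mul_assoc, mul_smul_comm, smul_smul, smul_zero, zpow_neg,
      zpow_ofNat] <;>
    match_scalars <;> field_simp
  · simp only [Fin.forall_fin_two, c00, c01, c10, c11, Matrix.cons_val_zero, Matrix.cons_val_one]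
    refine ⟨⟨forall_fin_three ?_ ?_ ?_, forall_fin_three ?_ ?_ ?_⟩,
      forall_fin_three ?_ ?_ ?_, forall_fin_three ?_ ?_ ?_⟩ <;>
    simp only [k11, k12, k13, k21, k22, k23, f11, f12, f13, f21, f22, f23, map_add, map_smul,
      map_mul, map_one, map_zero, smul_mul_assoc, mul_smul_comm, smul_smul, smul_zero, zpow_neg,
      zpow_ofNat, neg_neg] <;>
    match_scalars <;> field_simp
  · simp only [Fin.forall_fin_two, Matrix.cons_val_zero, Matrix.cons_val_one]
    refine ⟨⟨forall_fin_three ?_ ?_ ?_, forall_fin_three ?_ ?_ ?_⟩,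
      forall_fin_three ?_ ?_ ?_, forall_fin_three ?_ ?_ ?_⟩ <;>
    simp [k11, k12, k13, k21, k22, k23, l11, l12, l13, l21, l22, l23, e11, e12, e13, e21, e22, e23,
      f11, f12, f13, f21, f22, f23, E₁_mul, E₂_mul, F₁_mul, F₂_mul, E₁_one, E₂_one, F₁_one, F₂_one,
      x21, x31, x21', x32', mul_assoc, mul_add, add_mul, smul_smul, hξ', hinv, -mul_eq_mul_left_iff,
      -mul_eq_mul_right_iff] <;>
    match_scalars <;> field_simp <;> ring
  · simp only [Fin.forall_fin_two, c00, c01, c10, c11, Matrix.cons_val_zero, Matrix.cons_val_one]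
    refine ⟨⟨fun h => absurd h (by decide), fun _ => forall_fin_three ?_ ?_ ?_⟩,
      fun _ => forall_fin_three ?_ ?_ ?_, fun h => absurd h (by decide)⟩ <;>
    simp [k12, k13, k22, k23, e11, e12, e13, e21, e22, e23, E₁_mul, E₂_mul, E₁_one, E₂_one, x21,
      mul_assoc, mul_add, add_mul, smul_smul] <;>
    match_scalars <;> field_simp <;> ring
  · simp only [Fin.forall_fin_two, c00, c01, c10, c11, Matrix.cons_val_zero, Matrix.cons_val_one]
    refine ⟨⟨fun h => absurd h (by decide), fun _ => forall_fin_three ?_ ?_ ?_⟩,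
      fun _ => forall_fin_three ?_ ?_ ?_, fun h => absurd h (by decide)⟩ <;>
    simp [l11, l12, l13, l21, l22, l23, f11, f12, f13, f21, f22, f23, F₁_mul, F₂_mul, F₁_one,
      F₂_one, x21', x31', x32', mul_assoc, mul_add, add_mul, smul_smul] <;>
    match_scalars <;> (try rw [hξ']) <;> field_simp <;> ring
  · exact ⟨by simpa [Z1, UqslMA.ofGenerators, zpow_neg, zpow_ofNat] using k11, k12, k13, k21, k22,
      k23⟩
  · refine ⟨e11, e12, e13, e21, e22.trans ?_, e23, f11.trans ?_, f12, f13.trans ?_, f21, f22,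
      f23⟩ <;>
    simp only [Z1, Z2, Z3, pow_two, mul_assoc]

/-- Classification of `U_q(sl(3))`-module-algebra structures on `A_q(3)` in case
`(A2)|(B7)`: description, converse existence, and isomorphism with the normalized one. -/
theorem Uqsl3_on_Aq3_A2B7 (q : ℂ) (hq : q ≠ 0)
    (hq' : ∀ N : ℕ, 0 < N → q ^ N ≠ 1) :
    (∀ π : UqslMA q 2 (QSpace q 3), KCond14 q π →
      ∃ a₀ e₀ a₃ ξ₄ : ℂ, a₀ ≠ 0 ∧ e₀ ≠ 0 ∧ a₃ ≠ 0 ∧ ξ₄ ≠ 0 ∧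
        a₃ * ξ₄ = -q * e₀⁻¹ * a₀⁻¹ ∧ EFDesc14 q π a₀ e₀ a₃ ξ₄) ∧
    (∀ a₀ e₀ a₃ ξ₄ : ℂ, a₀ ≠ 0 → e₀ ≠ 0 → a₃ ≠ 0 → ξ₄ ≠ 0 →
      a₃ * ξ₄ = -q * e₀⁻¹ * a₀⁻¹ →
      ∃ π : UqslMA q 2 (QSpace q 3), KCond14 q π ∧ EFDesc14 q π a₀ e₀ a₃ ξ₄) ∧
    (∀ π π' : UqslMA q 2 (QSpace q 3),
      KCond14 q π → KCond14 q π' → EFDesc14 q π' 1 1 1 (-q) → π.Iso π') := by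
  refine ⟨fun π hπ => hπ.description hq hq', fun a₀ e₀ a₃ ξ₄ ha₀ he₀ ha₃ _ hξ =>
    exists_EFDesc14 hq hq' ha₀ he₀ ha₃ hξ, fun π π' hπ hπ' h' => ?_⟩
  obtain ⟨a₀, e₀, a₃, ξ₄, ha₀, he₀, ha₃, -, hξ, h⟩ := hπ.description hq hq'
  exact hπ.iso_of_EFDesc14 hπ' ha₀ he₀ ha₃ hξ h h'
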